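/- arXiv:2204.07529 — 2 statements merged into one kernel-verified Lean document; each statement's English description precedes it below -/
import Mathlib

section
/- Let α₁, α₂, p, c₁, c₂ > 0 with p > α₁·α₂, let ψ₁(s) = |s|^{α₁−1}·s and ψ₂(s) = |s|^{α₂−1}·s, let q be continuous on [a,c], and let f : ℝ → ℝ be odd and continuous with s·f(s) > 0 for s ≠ 0 and c₁·|s|^p ≤ |f(s)| ≤ c₂·|s|^p for all s ∈ ℝ. Suppose u is a nontrivial solution of (ψ₂((ψ₁(u'))'))' + q(x)·f(u) = 0 on [a,c] with a < b < c, u(a) = u(b) = u(c) = 0, and u(x) ≠ 0 for x ∈ (a,b) ∪ (b,c). Let M = max_{a≤x≤c} |u(x)| > 0. Then (2/(c−a))^{α₂(α₁+1)} < c₂ · M^{p−α₁α₂} · ∫ₐ^c |q(x)| dx. -/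
open Set

/-- The signed power has absolute value equal to the ordinary power. -/
lemma abs_signed_rpow {α : ℝ} (hα : 0 < α) (s : ℝ) :
    |(|s| ^ (α - 1) * s)| = |s| ^ α := by
  rcases eq_or_ne s 0 with rfl | hs
  · simp [Real.zero_rpow hα.ne']
  · have h : 0 < |s| := abs_pos.mpr hs
    rw [abs_mul, abs_of_nonneg (Real.rpow_nonneg h.le _), Real.rpow_sub_one h.ne',
      div_mul_cancel₀ _ h.ne']

lemma le_rpow_one_div_of_rpow_le {α s t : ℝ} (hα : 0 < α) (hs : 0 ≤ s) (h : s ^ α ≤ t) :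
    s ≤ t ^ (1 / α) := by
  have h' := Real.rpow_le_rpow (Real.rpow_nonneg hs α) h (one_div_pos.mpr hα).le
  rwa [← Real.rpow_mul hs, mul_one_div_cancel hα.ne', Real.rpow_one] at h'

/-- If `w' = -q g` with `|g| ≤ B` and `w` vanishes somewhere, then `|w| ≤ B ∫ |q|`. -/
lemma abs_le_mul_integral_of_deriv_eq {a c B ξ : ℝ} {q g w : ℝ → ℝ} (hac : a ≤ c)
    (hq : ContinuousOn q (Icc a c)) (hg : ContinuousOn g (Icc a c))
    (hw : Differentiable ℝ w) (hode : ∀ x ∈ Icc a c, deriv w x + q x * g x = 0)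
    (hB : ∀ x ∈ Icc a c, |g x| ≤ B) (hξ : ξ ∈ Icc a c) (hwξ : w ξ = 0) {x : ℝ}
    (hx : x ∈ Icc a c) : |w x| ≤ B * ∫ t in a..c, |q t| := by
  have hsub : uIcc ξ x ⊆ Icc a c := by
    rw [← uIcc_of_le hac] at hξ hx ⊢
    exact uIcc_subset_uIcc hξ hx
  have hcd : ContinuousOn (deriv w) (Icc a c) :=
    (hq.mul hg).neg.congr fun t ht => by
      simp only [Pi.neg_apply, Pi.mul_apply]
      linarith [hode t ht]
  have hBq : ContinuousOn (fun t => B * |q t|) (Icc a c) := continuousOn_const.mul hq.abs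
  have hB0 : 0 ≤ B := (abs_nonneg _).trans (hB x hx)
  have hint : ∫ t in ξ..x, deriv w t = w x - w ξ :=
    intervalIntegral.integral_deriv_eq_sub (fun t _ => hw t)
      (hcd.mono hsub).intervalIntegrable
  rw [hwξ, sub_zero] at hint
  rw [← hint, ← intervalIntegral.integral_const_mul]
  have hn : ‖∫ t in ξ..x, deriv w t‖ ≤ |(∫ t in ξ..x, B * |q t|)| := by
    refine intervalIntegral.norm_integral_le_abs_of_norm_le ?_
      (hBq.mono hsub).intervalIntegrable
    refine MeasureTheory.ae_restrict_of_forall_mem measurableSet_uIoc fun t ht => ?_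
    have ht' := hsub (uIoc_subset_uIcc ht)
    have : deriv w t = -(q t * g t) := by linarith [hode t ht']
    rw [this, Real.norm_eq_abs, abs_neg, abs_mul, mul_comm]
    exact mul_le_mul_of_nonneg_right (hB t ht') (abs_nonneg _)
  refine hn.trans ?_
  have hm : |(∫ t in ξ..x, B * |q t|)| ≤ |(∫ t in a..c, B * |q t|)| := by
    refine intervalIntegral.abs_integral_mono_interval ?_
      (Filter.Eventually.of_forall fun t => mul_nonneg hB0 (abs_nonneg _))
      (ContinuousOn.intervalIntegrable (by rwa [uIcc_of_le hac]))
    rw [uIoc_of_le hac]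
    rcases le_total ξ x with h | h
    · rw [uIoc_of_le h]; exact Ioc_subset_Ioc hξ.1 hx.2
    · rw [uIoc_of_ge h]; exact Ioc_subset_Ioc hx.1 hξ.2
  rwa [abs_of_nonneg (a := ∫ t in a..c, B * |q t|) (intervalIntegral.integral_nonneg hac
    fun t _ => mul_nonneg hB0 (abs_nonneg _))] at hm

/-- A function vanishing at both ends of an interval, whose quasi-derivative `φ_α ∘ u'` is
`K`-Lipschitz on that interval, is controlled at a critical point `x₀` by the distance to the
nearer end. -/
lemma exists_abs_le_of_critical_point {α l r x₀ K : ℝ} {u : ℝ → ℝ} (hα : 0 < α)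
    (hu : Differentiable ℝ u)
    (hv : Differentiable ℝ (fun x => |deriv u x| ^ (α - 1) * deriv u x))
    (hK : ∀ x ∈ Icc l r, |deriv (fun y => |deriv u y| ^ (α - 1) * deriv u y) x| ≤ K)
    (hl : u l = 0) (hr : u r = 0) (hx₀ : x₀ ∈ Ioo l r) (hd : deriv u x₀ = 0) :
    ∃ h, 0 < h ∧ h ≤ (r - l) / 2 ∧ |u x₀| ≤ (K * h) ^ (1 / α) * h := by
  have hK0 : 0 ≤ K := (abs_nonneg _).trans (hK x₀ (Ioo_subset_Icc_self hx₀))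
  have key : ∀ y ∈ Icc l r, u y = 0 →
      |u x₀| ≤ (K * |x₀ - y|) ^ (1 / α) * |x₀ - y| := by
    intro y hy huy
    have hsub : uIcc y x₀ ⊆ Icc l r := by
      have hlr : l ≤ r := (hx₀.1.trans hx₀.2).le
      have hx := Ioo_subset_Icc_self hx₀
      rw [← uIcc_of_le hlr] at hx hy ⊢
      exact uIcc_subset_uIcc hy hx
    have h1 : ∀ t ∈ uIcc y x₀, ‖deriv u t‖ ≤ (K * |x₀ - y|) ^ (1 / α) := by
      intro t ht
      refine le_rpow_one_div_of_rpow_le hα (norm_nonneg _) ?_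
      rw [Real.norm_eq_abs, ← abs_signed_rpow hα]
      have h2 := Convex.norm_image_sub_le_of_norm_deriv_le (fun t _ => hv t) hK
        (convex_Icc l r) (Ioo_subset_Icc_self hx₀) (hsub ht)
      simp only [hd, mul_zero, sub_zero, Real.norm_eq_abs] at h2
      refine h2.trans (mul_le_mul_of_nonneg_left ?_ hK0)
      rw [abs_sub_comm t x₀]
      exact abs_sub_right_of_mem_uIcc ht
    have h3 := Convex.norm_image_sub_le_of_norm_deriv_le (fun t _ => hu t) h1
      (convex_uIcc y x₀) left_mem_uIcc right_mem_uIcc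
    simpa [huy] using h3
  rcases le_total x₀ ((l + r) / 2) with h | h
  · refine ⟨|x₀ - l|, abs_pos.mpr (sub_ne_zero.mpr hx₀.1.ne'), ?_,
      key l (left_mem_Icc.mpr (hx₀.1.trans hx₀.2).le) hl⟩
    rw [abs_of_pos (sub_pos.mpr hx₀.1)]; linarith
  · refine ⟨|x₀ - r|, abs_pos.mpr (sub_ne_zero.mpr hx₀.2.ne), ?_,
      key r (right_mem_Icc.mpr (hx₀.1.trans hx₀.2).le) hr⟩
    rw [abs_of_neg (sub_neg.mpr hx₀.2)]; linarith

lemma two_div_rpow_lt_of_le {α₁ α₂ p c₂ M Q h H : ℝ} (hα₁ : 0 < α₁) (hα₂ : 0 < α₂)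
    (hM : 0 < M) (hN : 0 ≤ c₂ * M ^ p * Q) (hh : 0 < h) (hH : h < H / 2)
    (hle : M ≤ ((c₂ * M ^ p * Q) ^ (1 / α₂) * h) ^ (1 / α₁) * h) :
    (2 / H) ^ (α₂ * (α₁ + 1)) < c₂ * M ^ (p - α₁ * α₂) * Q := by
  set N := c₂ * M ^ p * Q with hNdef
  have hα : 0 < α₁ * α₂ := mul_pos hα₁ hα₂
  have he : 0 < α₂ * (α₁ + 1) := by positivity
  have hKh : 0 ≤ N ^ (1 / α₂) * h := by positivity
  have h1 : M ^ (α₁ * α₂) ≤ N * h ^ (α₂ * (α₁ + 1)) := by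
    refine (Real.rpow_le_rpow hM.le hle hα.le).trans_eq ?_
    rw [Real.mul_rpow (by positivity) hh.le, ← Real.rpow_mul hKh,
      show 1 / α₁ * (α₁ * α₂) = α₂ by field_simp, Real.mul_rpow (by positivity) hh.le,
      ← Real.rpow_mul hN, one_div_mul_cancel hα₂.ne', Real.rpow_one, mul_assoc,
      ← Real.rpow_add hh]
    congr 2; ring
  have hMα : 0 < M ^ (α₁ * α₂) := Real.rpow_pos_of_pos hM _
  have hNpos : 0 < N := by
    refine hN.lt_of_ne fun h0 => ?_
    rw [← h0, zero_mul] at h1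
    exact absurd h1 hMα.not_ge
  have h2 : M ^ (α₁ * α₂) < N * (H / 2) ^ (α₂ * (α₁ + 1)) :=
    h1.trans_lt (mul_lt_mul_of_pos_left (Real.rpow_lt_rpow hh.le hH he) hNpos)
  have hH0 : 0 < H / 2 := hh.trans hH
  rw [← inv_div, Real.inv_rpow hH0.le, Real.rpow_sub hM]
  rw [show c₂ * (M ^ p / M ^ (α₁ * α₂)) * Q = N / M ^ (α₁ * α₂) by rw [hNdef]; ring,
    inv_eq_one_div, div_lt_div_iff₀ (Real.rpow_pos_of_pos hH0 _) hMα, one_mul]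
  exact h2

theorem max_location_three_point
    (α₁ α₂ p c₁ c₂ a b c M : ℝ) (q f u : ℝ → ℝ)
    (hα₁ : 0 < α₁) (hα₂ : 0 < α₂) (hp : 0 < p) (hc₁ : 0 < c₁) (hc₂ : 0 < c₂)
    (hpα : α₁ * α₂ < p) (hab : a < b) (hbc : b < c)
    (hq : ContinuousOn q (Icc a c))
    (hfcont : Continuous f) (hfodd : ∀ s, f (-s) = -f s)
    (hfsgn : ∀ s : ℝ, s ≠ 0 → 0 < s * f s)
    (hfbound : ∀ s : ℝ, c₁ * |s| ^ p ≤ |f s| ∧ |f s| ≤ c₂ * |s| ^ p)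
    (hu : Differentiable ℝ u)
    (hu1 : Differentiable ℝ (fun x => |deriv u x| ^ (α₁ - 1) * deriv u x))
    (hu2 : Differentiable ℝ (fun x =>
      |deriv (fun y => |deriv u y| ^ (α₁ - 1) * deriv u y) x| ^ (α₂ - 1) *
        deriv (fun y => |deriv u y| ^ (α₁ - 1) * deriv u y) x))
    (hode : ∀ x ∈ Icc a c,
      deriv (fun y =>
        |deriv (fun z => |deriv u z| ^ (α₁ - 1) * deriv u z) y| ^ (α₂ - 1) *
          deriv (fun z => |deriv u z| ^ (α₁ - 1) * deriv u z) y) x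
        + q x * f (u x) = 0)
    (hua : u a = 0) (hub : u b = 0) (huc : u c = 0)
    (hune : ∀ x ∈ Ioo a b ∪ Ioo b c, u x ≠ 0)
    (hM : IsGreatest ((fun x => |u x|) '' Icc a c) M) (hMpos : 0 < M) :
    (2 / (c - a)) ^ (α₂ * (α₁ + 1)) <
      c₂ * M ^ (p - α₁ * α₂) * ∫ x in a..c, |q x| := by
  have hac : a < c := hab.trans hbc
  set v : ℝ → ℝ := fun x => |deriv u x| ^ (α₁ - 1) * deriv u x with hvdef
  have hvzero : ∀ x, deriv u x = 0 → v x = 0 := fun x hx => by simp [hvdef, hx]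
  obtain ⟨⟨x₀, hx₀, hux₀⟩, hmax⟩ := hM
  have hle : ∀ x ∈ Icc a c, |u x| ≤ M := fun x hx => hmax (mem_image_of_mem _ hx)
  have hne : u x₀ ≠ 0 := fun h => hMpos.ne (by simpa [h] using hux₀)
  have hx₀a : a < x₀ := hx₀.1.lt_of_ne fun h => hne (h ▸ hua)
  have hx₀c : x₀ < c := hx₀.2.lt_of_ne fun h => hne (h ▸ huc)
  have hx₀b : x₀ ≠ b := fun h => hne (h ▸ hub)
  have hd₀ : deriv u x₀ = 0 := by
    have hnhds : Icc a c ∈ nhds x₀ := Icc_mem_nhds hx₀a hx₀c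
    rcases lt_or_gt_of_ne hne with h | h
    · refine IsLocalMin.deriv_eq_zero (Filter.mem_of_superset hnhds fun x hx => ?_)
      have h1 := hle x hx
      simp only [abs_of_neg h] at hux₀
      simp only [mem_ofPred_eq]
      linarith [neg_abs_le (u x)]
    · refine IsLocalMax.deriv_eq_zero (Filter.mem_of_superset hnhds fun x hx => ?_)
      have h1 := hle x hx
      simp only [abs_of_pos h] at hux₀
      simp only [mem_ofPred_eq]
      linarith [le_abs_self (u x)]
  obtain ⟨y₁, hy₁, hdy₁⟩ := exists_deriv_eq_zero hab hu.continuous.continuousOn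
    (hua.trans hub.symm)
  obtain ⟨y₂, hy₂, hdy₂⟩ := exists_deriv_eq_zero hbc hu.continuous.continuousOn
    (hub.trans huc.symm)
  obtain ⟨ξ, hξ, hdξ⟩ := exists_deriv_eq_zero (hy₁.2.trans hy₂.1) hu1.continuous.continuousOn
    ((hvzero y₁ hdy₁).trans (hvzero y₂ hdy₂).symm)
  have hξ' : ξ ∈ Icc a c := ⟨(hy₁.1.trans hξ.1).le, (hξ.2.trans hy₂.2).le⟩
  have hf : ∀ x ∈ Icc a c, |f (u x)| ≤ c₂ * M ^ p := fun x hx =>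
    (hfbound (u x)).2.trans (mul_le_mul_of_nonneg_left
      (Real.rpow_le_rpow (abs_nonneg _) (hle x hx) hp.le) hc₂.le)
  have hK : ∀ x ∈ Icc a c,
      |deriv v x| ≤ (c₂ * M ^ p * ∫ t in a..c, |q t|) ^ (1 / α₂) := fun x hx => by
    refine le_rpow_one_div_of_rpow_le hα₂ (abs_nonneg _) ?_
    rw [← abs_signed_rpow hα₂]
    exact abs_le_mul_integral_of_deriv_eq hac.le hq
      (hfcont.comp hu.continuous).continuousOn hu2 hode hf hξ'
      (by simp [hdξ]) hx
  have hQ : 0 ≤ ∫ t in a..c, |q t| :=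
    intervalIntegral.integral_nonneg hac.le fun t _ => abs_nonneg _
  have hN : 0 ≤ c₂ * M ^ p * ∫ t in a..c, |q t| := by positivity
  obtain ⟨h, hh, hhH, hMh⟩ : ∃ h, 0 < h ∧ h < (c - a) / 2 ∧
      |u x₀| ≤ ((c₂ * M ^ p * ∫ t in a..c, |q t|) ^ (1 / α₂) * h) ^ (1 / α₁) * h := by
    rcases lt_or_gt_of_ne hx₀b with hlt | hgt
    · obtain ⟨h, h1, h2, h3⟩ := exists_abs_le_of_critical_point hα₁ hu hu1
        (fun x hx => hK x (Icc_subset_Icc_right hbc.le hx)) hua hub ⟨hx₀a, hlt⟩ hd₀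
      exact ⟨h, h1, by linarith, h3⟩
    · obtain ⟨h, h1, h2, h3⟩ := exists_abs_le_of_critical_point hα₁ hu hu1
        (fun x hx => hK x (Icc_subset_Icc_left hab.le hx)) hub huc ⟨hgt, hx₀c⟩ hd₀
      exact ⟨h, h1, by linarith, h3⟩
  exact two_div_rpow_lt_of_le hα₁ hα₂ hMpos hN hh hhH (hux₀ ▸ hMh)
end

section
/- Let α₁, α₂ > 0, let φ_p(s) = |s|^{p−1}·s, and let q be continuous on [a,c] with a < b < c. Suppose u is a nontrivial solution of the quasilinear equation (φ_{α₂}((φ_{α₁}(u'))'))' + q(x)·φ_{α₁α₂}(u) = 0 on [a,c] with u(a) = u(b) = u(c) = 0 and u(x) ≠ 0 for all x ∈ (a,b) ∪ (b,c). Then max_{ξ∈[a,c]} { ∫ₐ^ξ q₋(x) dx + ∫_ξ^c q₊(x) dx } > (2/(c−a))^{α₂(α₁+1)}. -/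
open Set

/-- The signed power function `s ↦ |s| ^ (p - 1) * s`. -/
noncomputable def signedPow (p s : ℝ) : ℝ := |s| ^ (p - 1) * s

lemma signedPow_of_pos (p : ℝ) {s : ℝ} (hs : 0 < s) : signedPow p s = s ^ p := by
  rw [signedPow, abs_of_pos hs, Real.rpow_sub_one hs.ne', div_mul_cancel₀ _ hs.ne']

lemma signedPow_neg (p s : ℝ) : signedPow p (-s) = -signedPow p s := by
  simp [signedPow]

lemma signedPow_zero (p : ℝ) : signedPow p 0 = 0 := by simp [signedPow]

lemma signedPow_of_neg (p : ℝ) {s : ℝ} (hs : s < 0) : signedPow p s = -(-s) ^ p := by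
  rw [← signedPow_of_pos p (neg_pos.2 hs), signedPow_neg, neg_neg]

lemma signedPow_nonneg (p : ℝ) {s : ℝ} (hs : 0 ≤ s) : 0 ≤ signedPow p s :=
  mul_nonneg (by positivity) hs

lemma signedPow_nonpos (p : ℝ) {s : ℝ} (hs : s ≤ 0) : signedPow p s ≤ 0 :=
  mul_nonpos_of_nonneg_of_nonpos (by positivity) hs

lemma abs_signedPow_le {p s M : ℝ} (hp : 0 < p) (h : |s| ≤ M) : |signedPow p s| ≤ M ^ p := by
  rcases eq_or_ne s 0 with rfl | hs
  · rw [signedPow_zero, abs_zero]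
    exact Real.rpow_nonneg ((abs_nonneg _).trans h) p
  · have hs' : 0 < |s| := abs_pos.2 hs
    calc |signedPow p s| = |s| ^ p := by
          rw [signedPow, abs_mul, abs_of_nonneg (by positivity : 0 ≤ |s| ^ (p - 1)),
            Real.rpow_sub_one hs'.ne', div_mul_cancel₀ _ hs'.ne']
      _ ≤ M ^ p := Real.rpow_le_rpow hs'.le h hp.le

lemma neg_le_of_neg_rpow_le_signedPow {p s t : ℝ} (hp : 0 < p) (ht : 0 ≤ t)
    (h : -t ^ p ≤ signedPow p s) : -t ≤ s := by
  by_contra! hst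
  rw [signedPow_of_neg p (by linarith)] at h
  have := Real.rpow_lt_rpow ht (show t < -s by linarith) hp
  linarith

/-- The estimate of the integral of a derivative over a subinterval of `[A, B]`. -/
lemma sub_le_integral_mul_of_hasDerivAt_le {a c A B s t G : ℝ} {w w' h : ℝ → ℝ}
    (hw : ∀ x ∈ Icc a c, HasDerivAt w (w' x) x) (hc : ContinuousOn h (Icc a c))
    (h0 : ∀ x, 0 ≤ h x) (hG : 0 ≤ G) (haA : a ≤ A) (hAs : A ≤ s) (hst : s ≤ t) (htB : t ≤ B)
    (hBc : B ≤ c) (hle : ∀ x ∈ Icc s t, w' x ≤ h x * G) :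
    w t - w s ≤ (∫ x in A..B, h x) * G := by
  have hsub : Icc s t ⊆ Icc a c := Icc_subset_Icc (by linarith) (by linarith)
  have h1 : w t - w s ≤ ∫ x in s..t, h x * G := by
    refine intervalIntegral.sub_le_integral_of_hasDeriv_right_of_le hst
      (fun x hx => (hw x (hsub hx)).continuousAt.continuousWithinAt)
      (fun x hx => (hw x (hsub (Ioo_subset_Icc_self hx))).hasDerivWithinAt)
      (((hc.mono hsub).mul continuousOn_const).integrableOn_Icc)
      (fun x hx => hle x (Ioo_subset_Icc_self hx))
  rw [intervalIntegral.integral_mul_const] at h1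
  refine h1.trans (mul_le_mul_of_nonneg_right ?_ hG)
  refine intervalIntegral.integral_mono_interval hAs hst htB (Filter.Eventually.of_forall h0) ?_
  refine ContinuousOn.intervalIntegrable ?_
  rw [uIcc_of_le (by linarith)]
  exact hc.mono (Icc_subset_Icc haA hBc)

/-- A continuous function with no zeros strictly between two consecutive zeros has constant sign. -/
lemma nonneg_or_nonpos_on_Icc {u : ℝ → ℝ} {p r : ℝ} (hu : Continuous u) (hp : u p = 0)
    (hr : u r = 0) (hne : ∀ x ∈ Ioo p r, u x ≠ 0) :
    (∀ x ∈ Icc p r, 0 ≤ u x) ∨ (∀ x ∈ Icc p r, u x ≤ 0) := by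
  by_contra! h
  obtain ⟨⟨x, hx, hux⟩, y, hy, huy⟩ := h
  have mem : ∀ z ∈ Icc p r, u z ≠ 0 → z ∈ Ioo p r := fun z hz h =>
    ⟨hz.1.lt_of_ne (by rintro rfl; exact h hp), hz.2.lt_of_ne (by rintro rfl; exact h hr)⟩
  obtain ⟨z, hz, huz⟩ := intermediate_value_uIcc (hu.continuousOn (s := uIcc x y))
    (show (0 : ℝ) ∈ uIcc (u x) (u y) from mem_uIcc.2 (Or.inl ⟨hux.le, huy.le⟩))
  exact hne z (ordConnected_Ioo.uIcc_subset (mem x hx hux.ne) (mem y hy huy.ne') hz) huz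

lemma rpow_le_of_quotient_rpow_le {α β K M h δ : ℝ} (hα : 0 < α) (hβ : 0 < β) (hK : 0 ≤ K)
    (hM : 0 < M) (hδ : 0 < δ) (hδh : δ ≤ h)
    (hle : (M / δ) ^ α ≤ K ^ (1 / β) * M ^ α * h) : (1 / h) ^ (β * (α + 1)) ≤ K := by
  have hh : 0 < h := hδ.trans_le hδh
  have h1 : (M / h) ^ α ≤ K ^ (1 / β) * M ^ α * h :=
    (Real.rpow_le_rpow (by positivity) (by gcongr) hα.le).trans hle
  have hMα : 0 < M ^ α := by positivity
  have h2 : (1 / h) ^ (α + 1) ≤ K ^ (1 / β) := by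
    rw [Real.rpow_add (by positivity), Real.rpow_one]
    rw [show M / h = M * (1 / h) by ring, Real.mul_rpow hM.le (by positivity)] at h1
    have h3 : (1 / h) ^ α ≤ K ^ (1 / β) * h := by
      refine le_of_mul_le_mul_left ?_ hMα
      linarith
    rw [mul_one_div, div_le_iff₀ hh]
    exact h3
  calc (1 / h) ^ (β * (α + 1)) = ((1 / h) ^ (α + 1)) ^ β := by
        rw [← Real.rpow_mul (by positivity), mul_comm]
    _ ≤ (K ^ (1 / β)) ^ β := Real.rpow_le_rpow (by positivity) h2 hβ.le
    _ = K := by rw [← Real.rpow_mul hK, one_div_mul_cancel hβ.ne', Real.rpow_one]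

/-- A one-sided bound for `signedPow β v'`, where `v = signedPow α u'`, on an interval at whose
end points `u` vanishes forces the constant of that bound to be large. -/
lemma rpow_le_of_neg_le_signedPow_deriv {α β K M p r x₀ : ℝ} {u u' v' : ℝ → ℝ}
    (hα : 0 < α) (hβ : 0 < β) (hK : 0 ≤ K) (hM : 0 < M) (hx₀ : x₀ ∈ Ioo p r)
    (hu : ∀ x, HasDerivAt u (u' x) x) (hv : ∀ x, HasDerivAt (fun y => signedPow α (u' y)) (v' x) x)
    (hup : u p = 0) (hur : u r = 0) (hux₀ : u x₀ = M) (hu'x₀ : u' x₀ = 0)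
    (hw : ∀ x ∈ Icc p r, -(K * M ^ (α * β)) ≤ signedPow β (v' x)) :
    (2 / (r - p)) ^ (β * (α + 1)) ≤ K := by
  obtain ⟨hp, hr⟩ := hx₀
  set k := K ^ (1 / β) * M ^ α with hk
  have hk0 : 0 ≤ k := by positivity
  have hkβ : k ^ β = K * M ^ (α * β) := by
    rw [hk, Real.mul_rpow (by positivity) (by positivity), ← Real.rpow_mul hK,
      one_div_mul_cancel hβ.ne', Real.rpow_one, ← Real.rpow_mul hM.le]
  have hv' : ∀ x ∈ Icc p r, -k ≤ v' x := fun x hx =>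
    neg_le_of_neg_rpow_le_signedPow hβ hk0 (by rw [hkβ]; exact hw x hx)
  have huc : Continuous u := continuous_iff_continuousAt.2 fun x => (hu x).continuousAt
  have hvc : Continuous fun y => signedPow α (u' y) :=
    continuous_iff_continuousAt.2 fun x => (hv x).continuousAt
  have hvx₀ : signedPow α (u' x₀) = 0 := by rw [hu'x₀, signedPow_zero]
  rw [show 2 / (r - p) = 1 / ((r - p) / 2) by rw [one_div_div]]
  rcases le_total (x₀ - p) ((r - p) / 2) with hle | hle
  · obtain ⟨η, hη, h1⟩ := exists_hasDerivAt_eq_slope u u' hp huc.continuousOn fun x _ => hu x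
    obtain ⟨ζ, hζ, h2⟩ := exists_hasDerivAt_eq_slope _ v' hη.2 hvc.continuousOn fun x _ => hv x
    rw [hux₀, hup, sub_zero] at h1
    have hδ : 0 < x₀ - p := sub_pos.2 hp
    refine rpow_le_of_quotient_rpow_le hα hβ hK hM hδ hle ?_
    rw [← signedPow_of_pos α (by positivity), ← h1]
    have h3 := hv' ζ ⟨by linarith [hη.1, hζ.1], by linarith [hζ.2]⟩
    rw [h2, hvx₀, le_div_iff₀ (sub_pos.2 hη.2)] at h3
    have : k * (x₀ - η) ≤ k * ((r - p) / 2) :=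
      mul_le_mul_of_nonneg_left (by linarith [hη.1]) hk0
    linarith
  · obtain ⟨η, hη, h1⟩ := exists_hasDerivAt_eq_slope u u' hr huc.continuousOn fun x _ => hu x
    obtain ⟨ζ, hζ, h2⟩ := exists_hasDerivAt_eq_slope _ v' hη.1 hvc.continuousOn fun x _ => hv x
    rw [hux₀, hur, zero_sub, neg_div] at h1
    have hδ : 0 < r - x₀ := sub_pos.2 hr
    refine rpow_le_of_quotient_rpow_le hα hβ hK hM hδ (by linarith) ?_
    rw [← signedPow_of_pos α (by positivity), ← neg_neg (M / (r - x₀)), ← h1, signedPow_neg]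
    have h3 := hv' ζ ⟨by linarith [hζ.1], by linarith [hη.2, hζ.2]⟩
    rw [h2, hvx₀, le_div_iff₀ (sub_pos.2 hη.1)] at h3
    have : k * (η - x₀) ≤ k * ((r - p) / 2) :=
      mul_le_mul_of_nonneg_left (by linarith [hη.2]) hk0
    linarith

/-- Three zeros of `u`, with `|u|` maximal at a point where `u` is positive, yield an interval
between two consecutive zeros on which `w` has a one-sided bound. -/
lemma exists_interval_neg_le {a b c x₀ G : ℝ} {q u u' v v' w g : ℝ → ℝ}
    (hab : a < b) (hbc : b < c) (hq : ContinuousOn q (Icc a c))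
    (hu : ∀ x, HasDerivAt u (u' x) x) (hv : ∀ x, HasDerivAt v (v' x) x)
    (hw : ∀ x ∈ Icc a c, HasDerivAt w (-(q x * g x)) x)
    (hv0 : ∀ x, u' x = 0 → v x = 0) (hw0 : ∀ x, v' x = 0 → w x = 0)
    (hg0 : ∀ x, 0 ≤ u x → 0 ≤ g x) (hg0' : ∀ x, u x ≤ 0 → g x ≤ 0)
    (hG : ∀ x ∈ Icc a c, |g x| ≤ G)
    (hua : u a = 0) (hub : u b = 0) (huc : u c = 0)
    (hune : ∀ x ∈ Ioo a b ∪ Ioo b c, u x ≠ 0)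
    (hx₀ : x₀ ∈ Icc a c) (hpos : 0 < u x₀) (hmax : ∀ x ∈ Icc a c, |u x| ≤ u x₀) :
    ∃ p r ξ, x₀ ∈ Ioo p r ∧ r - p < c - a ∧ u p = 0 ∧ u r = 0 ∧ u' x₀ = 0 ∧ ξ ∈ Icc a c ∧
      ∀ x ∈ Icc p r,
        -(((∫ x in a..ξ, max (-q x) 0) + (∫ x in ξ..c, max (q x) 0)) * G) ≤ w x := by
  have hucont : Continuous u := continuous_iff_continuousAt.2 fun x => (hu x).continuousAt
  have hvcont : Continuous v := continuous_iff_continuousAt.2 fun x => (hv x).continuousAt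
  have hG0 : 0 ≤ G := (abs_nonneg _).trans (hG x₀ hx₀)
  have hqm : ContinuousOn (fun x => max (-q x) 0) (Icc a c) := hq.neg.sup continuousOn_const
  have hqp : ContinuousOn (fun x => max (q x) 0) (Icc a c) := hq.sup continuousOn_const
  have hw' : ∀ x ∈ Icc a c, HasDerivAt (fun y => -w y) (q x * g x) x := fun x hx => by
    simpa using (hw x hx).fun_neg
  have key : ∀ s t G : ℝ, 0 ≤ t → t ≤ G → s * t ≤ max s 0 * G := fun s t G h0 h1 =>
    (mul_le_mul_of_nonneg_right (le_max_left s 0) h0).trans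
      (mul_le_mul_of_nonneg_left h1 (le_max_right s 0))
  have hneg : ∀ A B s t, a ≤ A → A ≤ s → s ≤ t → t ≤ B → B ≤ c →
      (∀ x ∈ Icc s t, 0 ≤ u x) → w t - w s ≤ (∫ x in A..B, max (-q x) 0) * G := by
    intro A B s t h1 h2 h3 h4 h5 h6
    refine sub_le_integral_mul_of_hasDerivAt_le hw hqm (fun _ => le_max_right _ _) hG0
      h1 h2 h3 h4 h5 fun x hx => ?_
    have := key (-q x) (g x) G (hg0 x (h6 x hx))
      ((le_abs_self _).trans (hG x ⟨by linarith [hx.1], by linarith [hx.2]⟩))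
    linarith
  have hneg' : ∀ A B s t, a ≤ A → A ≤ s → s ≤ t → t ≤ B → B ≤ c →
      (∀ x ∈ Icc s t, u x ≤ 0) → -w t - -w s ≤ (∫ x in A..B, max (-q x) 0) * G := by
    intro A B s t h1 h2 h3 h4 h5 h6
    refine sub_le_integral_mul_of_hasDerivAt_le (w := fun y => -w y) hw' hqm (fun _ => le_max_right _ _) hG0
      h1 h2 h3 h4 h5 fun x hx => ?_
    have := key (-q x) (-g x) G (by linarith [hg0' x (h6 x hx)])
      ((neg_le_abs _).trans (hG x ⟨by linarith [hx.1], by linarith [hx.2]⟩))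
    linarith
  have hpl : ∀ A B s t, a ≤ A → A ≤ s → s ≤ t → t ≤ B → B ≤ c →
      (∀ x ∈ Icc s t, 0 ≤ u x) → -w t - -w s ≤ (∫ x in A..B, max (q x) 0) * G := by
    intro A B s t h1 h2 h3 h4 h5 h6
    exact sub_le_integral_mul_of_hasDerivAt_le (w := fun y => -w y) hw' hqp (fun _ => le_max_right _ _) hG0
      h1 h2 h3 h4 h5 fun x hx => key (q x) (g x) G (hg0 x (h6 x hx))
      ((le_abs_self _).trans (hG x ⟨by linarith [hx.1], by linarith [hx.2]⟩))
  have hpl' : ∀ A B s t, a ≤ A → A ≤ s → s ≤ t → t ≤ B → B ≤ c →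
      (∀ x ∈ Icc s t, u x ≤ 0) → w t - w s ≤ (∫ x in A..B, max (q x) 0) * G := by
    intro A B s t h1 h2 h3 h4 h5 h6
    refine sub_le_integral_mul_of_hasDerivAt_le hw hqp (fun _ => le_max_right _ _) hG0
      h1 h2 h3 h4 h5 fun x hx => ?_
    have := key (q x) (-g x) G (by linarith [hg0' x (h6 x hx)])
      ((neg_le_abs _).trans (hG x ⟨by linarith [hx.1], by linarith [hx.2]⟩))
    linarith
  have hne : x₀ ≠ a ∧ x₀ ≠ b ∧ x₀ ≠ c := by
    refine ⟨?_, ?_, ?_⟩ <;> rintro rfl <;> linarith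
  have hx₀' : x₀ ∈ Ioo a c := ⟨hx₀.1.lt_of_ne' hne.1, hx₀.2.lt_of_ne hne.2.2⟩
  have hu'x₀ : u' x₀ = 0 := by
    refine IsLocalMax.hasDerivAt_eq_zero ?_ (hu x₀)
    filter_upwards [Icc_mem_nhds hx₀'.1 hx₀'.2] with x hx
    exact (le_abs_self _).trans (hmax x hx)
  have hrolle : ∀ s t, s < t → u' s = 0 → u' t = 0 → ∃ d ∈ Ioo s t, w d = 0 := by
    intro s t hst hs ht
    obtain ⟨d, hd, h⟩ := exists_hasDerivAt_eq_zero hst hvcont.continuousOn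
      ((hv0 s hs).trans (hv0 t ht).symm) fun x _ => hv x
    exact ⟨d, hd, hw0 d h⟩
  have hinside : ∀ p r d, a ≤ p → r ≤ c → d ∈ Icc p r → w d = 0 → (∀ x ∈ Icc p r, 0 ≤ u x) →
      ∀ x ∈ Icc p r,
        -(((∫ x in a..d, max (-q x) 0) + (∫ x in d..c, max (q x) 0)) * G) ≤ w x := by
    intro p r d hp hr hd hwd hnn x hx
    have i1 : 0 ≤ (∫ x in a..d, max (-q x) 0) * G := mul_nonneg
      (intervalIntegral.integral_nonneg (by linarith [hd.1]) fun _ _ => le_max_right _ _) hG0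
    have i2 : 0 ≤ (∫ x in d..c, max (q x) 0) * G := mul_nonneg
      (intervalIntegral.integral_nonneg (by linarith [hd.2]) fun _ _ => le_max_right _ _) hG0
    rcases le_total x d with h | h
    · have := hneg a d x d le_rfl (by linarith [hx.1]) h le_rfl (by linarith [hd.2])
        fun y hy => hnn y ⟨hx.1.trans hy.1, hy.2.trans hd.2⟩
      linarith
    · have := hpl d c d x (by linarith [hd.1]) le_rfl h (by linarith [hx.2]) le_rfl
        fun y hy => hnn y ⟨hd.1.trans hy.1, hy.2.trans hx.2⟩
      linarith
  have hflat : (∀ x ∈ Icc a c, 0 ≤ u x) → u' b = 0 := by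
    intro h
    refine IsLocalMin.hasDerivAt_eq_zero ?_ (hu b)
    filter_upwards [Icc_mem_nhds hab hbc] with x hx
    rw [hub]
    exact h x hx
  have hL := nonneg_or_nonpos_on_Icc hucont hua hub fun x hx => hune x (Or.inl hx)
  have hR := nonneg_or_nonpos_on_Icc hucont hub huc fun x hx => hune x (Or.inr hx)
  rcases lt_or_gt_of_ne hne.2.1 with hlt | hgt
  · have hL' : ∀ x ∈ Icc a b, 0 ≤ u x := hL.resolve_right fun h =>
      absurd (h x₀ ⟨hx₀.1, hlt.le⟩) hpos.not_ge
    suffices H : ∃ ξ ∈ Icc a c, ∀ x ∈ Icc a b,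
        -(((∫ x in a..ξ, max (-q x) 0) + (∫ x in ξ..c, max (q x) 0)) * G) ≤ w x by
      obtain ⟨ξ, hξ, H⟩ := H
      exact ⟨a, b, ξ, ⟨hx₀'.1, hlt⟩, by linarith, hua, hub, hu'x₀, hξ, H⟩
    rcases hR with hR | hR
    · obtain ⟨d, hd, hwd⟩ := hrolle x₀ b hlt hu'x₀ (hflat fun x hx =>
        (le_total x b).elim (fun h => hL' x ⟨hx.1, h⟩) fun h => hR x ⟨h, hx.2⟩)
      have hd' : d ∈ Icc a b := ⟨by linarith [hd.1, hx₀.1], hd.2.le⟩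
      exact ⟨d, ⟨hd'.1, hd'.2.trans hbc.le⟩, hinside a b d le_rfl hbc.le hd' hwd hL'⟩
    · obtain ⟨ξ, hξ, hξ0⟩ := exists_hasDerivAt_eq_zero hbc hucont.continuousOn
        (hub.trans huc.symm) fun x _ => hu x
      obtain ⟨d, hd, hwd⟩ := hrolle x₀ ξ (hlt.trans hξ.1) hu'x₀ hξ0
      have had : a ≤ d := by linarith [hd.1, hx₀.1]
      have hdc : d ≤ c := by linarith [hd.2, hξ.2]
      rcases le_total d b with h | h
      · exact ⟨d, ⟨had, hdc⟩, hinside a b d le_rfl hbc.le ⟨had, h⟩ hwd hL'⟩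
      · refine ⟨b, ⟨hab.le, hbc.le⟩, fun x hx => ?_⟩
        have h1 := hneg a b x b le_rfl hx.1 hx.2 le_rfl hbc.le
          fun y hy => hL' y ⟨hx.1.trans hy.1, hy.2⟩
        have h2 := hpl' b c b d hab.le le_rfl h hdc le_rfl
          fun y hy => hR y ⟨hy.1, hy.2.trans hdc⟩
        linarith
  · have hR' : ∀ x ∈ Icc b c, 0 ≤ u x := hR.resolve_right fun h =>
      absurd (h x₀ ⟨hgt.le, hx₀.2⟩) hpos.not_ge
    suffices H : ∃ ξ ∈ Icc a c, ∀ x ∈ Icc b c,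
        -(((∫ x in a..ξ, max (-q x) 0) + (∫ x in ξ..c, max (q x) 0)) * G) ≤ w x by
      obtain ⟨ξ, hξ, H⟩ := H
      exact ⟨b, c, ξ, ⟨hgt, hx₀'.2⟩, by linarith, hub, huc, hu'x₀, hξ, H⟩
    rcases hL with hL | hL
    · obtain ⟨d, hd, hwd⟩ := hrolle b x₀ hgt (hflat fun x hx =>
        (le_total x b).elim (fun h => hL x ⟨hx.1, h⟩) fun h => hR' x ⟨h, hx.2⟩) hu'x₀
      have hd' : d ∈ Icc b c := ⟨hd.1.le, by linarith [hd.2, hx₀.2]⟩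
      exact ⟨d, ⟨hab.le.trans hd'.1, hd'.2⟩, hinside b c d hab.le le_rfl hd' hwd hR'⟩
    · obtain ⟨ξ, hξ, hξ0⟩ := exists_hasDerivAt_eq_zero hab hucont.continuousOn
        (hua.trans hub.symm) fun x _ => hu x
      obtain ⟨d, hd, hwd⟩ := hrolle ξ x₀ (hξ.2.trans hgt) hξ0 hu'x₀
      have had : a ≤ d := by linarith [hd.1, hξ.1]
      have hdc : d ≤ c := by linarith [hd.2, hx₀.2]
      rcases le_total b d with h | h
      · exact ⟨d, ⟨had, hdc⟩, hinside b c d hab.le le_rfl ⟨h, hdc⟩ hwd hR'⟩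
      · refine ⟨b, ⟨hab.le, hbc.le⟩, fun x hx => ?_⟩
        have h1 := hpl b c b x hab.le le_rfl hx.1 hx.2 le_rfl
          fun y hy => hR' y ⟨hy.1, hy.2.trans hx.2⟩
        have h2 := hneg' a b d b le_rfl had h le_rfl hbc.le
          fun y hy => hL y ⟨had.trans hy.1, hy.2⟩
        linarith

/-- The lower bound for the coefficient when `|u|` is maximal at a point where `u` is positive. -/
lemma exists_integral_gt_of_max_pos {α₁ α₂ a b c x₀ : ℝ} {q u u' v' : ℝ → ℝ}
    (hα₁ : 0 < α₁) (hα₂ : 0 < α₂) (hab : a < b) (hbc : b < c) (hq : ContinuousOn q (Icc a c))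
    (hu : ∀ x, HasDerivAt u (u' x) x)
    (hv : ∀ x, HasDerivAt (fun y => signedPow α₁ (u' y)) (v' x) x)
    (hw : ∀ x ∈ Icc a c,
      HasDerivAt (fun y => signedPow α₂ (v' y)) (-(q x * signedPow (α₁ * α₂) (u x))) x)
    (hua : u a = 0) (hub : u b = 0) (huc : u c = 0)
    (hune : ∀ x ∈ Ioo a b ∪ Ioo b c, u x ≠ 0)
    (hx₀ : x₀ ∈ Icc a c) (hpos : 0 < u x₀) (hmax : ∀ x ∈ Icc a c, |u x| ≤ u x₀) :
    ∃ ξ ∈ Icc a c,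
      (∫ x in a..ξ, max (-q x) 0) + (∫ x in ξ..c, max (q x) 0) >
        (2 / (c - a)) ^ (α₂ * (α₁ + 1)) := by
  obtain ⟨p, r, ξ, hpr, hlen, hup, hur, hu'x₀, hξ, H⟩ := exists_interval_neg_le hab hbc hq hu hv hw
    (fun x h => by rw [h, signedPow_zero]) (fun x h => by rw [h, signedPow_zero])
    (fun x h => signedPow_nonneg _ h) (fun x h => signedPow_nonpos _ h)
    (fun x hx => abs_signedPow_le (mul_pos hα₁ hα₂) (hmax x hx)) hua hub huc hune hx₀ hpos hmax
  have hK : 0 ≤ (∫ x in a..ξ, max (-q x) 0) + (∫ x in ξ..c, max (q x) 0) := add_nonneg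
    (intervalIntegral.integral_nonneg hξ.1 fun _ _ => le_max_right _ _)
    (intervalIntegral.integral_nonneg hξ.2 fun _ _ => le_max_right _ _)
  have hlen0 : 0 < r - p := by linarith [hpr.1, hpr.2]
  refine ⟨ξ, hξ, lt_of_lt_of_le ?_ (rpow_le_of_neg_le_signedPow_deriv hα₁ hα₂ hK hpos hpr hu hv
    hup hur rfl hu'x₀ H)⟩
  refine Real.rpow_lt_rpow (div_nonneg zero_le_two (by linarith)) ?_ (by positivity)
  exact div_lt_div_of_pos_left two_pos hlen0 hlen



theorem quasilinear_three_point
    (α₁ α₂ a b c : ℝ) (q u : ℝ → ℝ)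
    (hα₁ : 0 < α₁) (hα₂ : 0 < α₂) (hab : a < b) (hbc : b < c)
    (hq : ContinuousOn q (Icc a c))
    (hu : Differentiable ℝ u)
    (hu1 : Differentiable ℝ (fun x => |deriv u x| ^ (α₁ - 1) * deriv u x))
    (hu2 : Differentiable ℝ (fun x =>
      |deriv (fun y => |deriv u y| ^ (α₁ - 1) * deriv u y) x| ^ (α₂ - 1) *
        deriv (fun y => |deriv u y| ^ (α₁ - 1) * deriv u y) x))
    (hode : ∀ x ∈ Icc a c,
      deriv (fun y =>
        |deriv (fun z => |deriv u z| ^ (α₁ - 1) * deriv u z) y| ^ (α₂ - 1) *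
          deriv (fun z => |deriv u z| ^ (α₁ - 1) * deriv u z) y) x
        + q x * (|u x| ^ (α₁ * α₂ - 1) * u x) = 0)
    (hua : u a = 0) (hub : u b = 0) (huc : u c = 0)
    (hune : ∀ x ∈ Ioo a b ∪ Ioo b c, u x ≠ 0) :
    ∃ ξ ∈ Icc a c,
      (∫ x in a..ξ, max (-q x) 0) + (∫ x in ξ..c, max (q x) 0) >
        (2 / (c - a)) ^ (α₂ * (α₁ + 1)) := by
  have hucont : Continuous u := hu.continuous
  obtain ⟨x₀, hx₀, hmax⟩ := isCompact_Icc.exists_isMaxOn (nonempty_Icc.2 (hab.trans hbc).le)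
    hucont.abs.continuousOn
  have hmax' : ∀ x ∈ Icc a c, |u x| ≤ |u x₀| := hmax
  have hu' : ∀ x, HasDerivAt u (deriv u x) x := fun x => (hu x).hasDerivAt
  let v : ℝ → ℝ := fun y => signedPow α₁ (deriv u y)
  have hv : ∀ x, HasDerivAt v (deriv v x) x := fun x => (hu1 x).hasDerivAt
  have hw : ∀ x ∈ Icc a c, HasDerivAt (fun y => signedPow α₂ (deriv v y))
      (-(q x * signedPow (α₁ * α₂) (u x))) x := fun x hx => by
    have h := (hu2 x).hasDerivAt
    rw [eq_neg_of_add_eq_zero_left (hode x hx)] at h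
    exact h
  have hx₀0 : u x₀ ≠ 0 := by
    intro h
    have hm : (a + b) / 2 ∈ Ioo a b := ⟨by linarith, by linarith⟩
    have := hmax' ((a + b) / 2) ⟨hm.1.le, hm.2.le.trans hbc.le⟩
    rw [h, abs_zero] at this
    exact hune _ (Or.inl hm) (abs_nonpos_iff.1 this)
  rcases lt_or_gt_of_ne hx₀0 with h | h
  · rw [abs_of_neg h] at hmax'
    refine exists_integral_gt_of_max_pos (u := fun x => -u x) (u' := fun x => -deriv u x)
      (v' := fun x => -deriv v x) hα₁ hα₂ hab hbc hq (fun x => (hu' x).neg) (fun x => ?_)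
      (fun x hx => ?_) (by simp [hua]) (by simp [hub]) (by simp [huc])
      (fun x hx => neg_ne_zero.2 (hune x hx)) hx₀ (neg_pos.2 h) (fun x hx => ?_)
    · simpa only [signedPow_neg] using (hv x).fun_neg
    · simpa only [signedPow_neg, mul_neg] using (hw x hx).fun_neg
    · simpa only [abs_neg] using hmax' x hx
  · rw [abs_of_pos h] at hmax'
    exact exists_integral_gt_of_max_pos hα₁ hα₂ hab hbc hq hu' hv hw hua hub huc hune hx₀ h hmax'
end
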